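/- There is no sequence of pairs (Uₙ, Vₙ)_{n ≥ 1} with each Uₙ open in ℝ, each Vₙ regular open in ℝ, Uₙ ⊆ Vₙ, and (-1/n, 1/n) ⊆ Uₙ for all n, such that interior(⋂ₙ Uₙ) = ℝ \ {0} and interior(⋂ₙ Vₙ) = ℝ. -/

import Mathlib

/-- There is no sequence of pairs `(Uₙ, Vₙ)` (for `n ≥ 1`) with each `Uₙ`
open in ℝ, each `Vₙ` regular open in ℝ, `Uₙ ⊆ Vₙ`, and `(-1/n, 1/n) ⊆ Uₙ` for all `n`,
such that `interior (⋂ₙ Uₙ) = ℝ \ {0}` and `interior (⋂ₙ Vₙ) = ℝ`. -/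
theorem no_sequence_of_pairs_inf_eq_compl_zero :
    ¬ ∃ U V : ℕ → Set ℝ,
      (∀ n, 1 ≤ n → IsOpen (U n)) ∧
      (∀ n, 1 ≤ n → V n = interior (closure (V n))) ∧
      (∀ n, 1 ≤ n → U n ⊆ V n) ∧
      (∀ n : ℕ, 1 ≤ n → Set.Ioo (-(1 / (n : ℝ))) (1 / (n : ℝ)) ⊆ U n) ∧
      interior (⋂ (n : ℕ) (_ : 1 ≤ n), U n) = {(0 : ℝ)}ᶜ ∧
      interior (⋂ (n : ℕ) (_ : 1 ≤ n), V n) = Set.univ := by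
  rintro ⟨U, V, -, -, -, hI, hU, -⟩
  have h : (⋂ (n : ℕ) (_ : 1 ≤ n), U n) = Set.univ := by
    refine Set.eq_univ_of_forall fun x => ?_
    by_cases hx : x = 0
    · subst hx
      refine Set.mem_iInter₂.2 fun n hn => hI n hn ?_
      have hpos : (0 : ℝ) < 1 / (n : ℝ) := one_div_pos.2 (by exact_mod_cast hn)
      exact ⟨by linarith, hpos⟩
    · have hx' : x ∈ ({(0 : ℝ)}ᶜ : Set ℝ) := hx
      rw [← hU] at hx'
      exact interior_subset hx'
  rw [h, interior_univ] at hU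
  have h0 : (0 : ℝ) ∈ ({(0 : ℝ)}ᶜ : Set ℝ) := hU ▸ Set.mem_univ _
  exact h0 rfl
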